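/- arXiv:1811.01270 — 3 statements merged into one kernel-verified Lean document; each statement's English description precedes it below -/
import Mathlib

section
/- Under the exclusive policy, if T ≤ M then the strategy A★ is non-redundant and sgreedy. -/
open Finset

/-- `A` is a doubly-substochastic `M × T` matrix: boxes `1..M`, rounds `1..T`,
nonnegative entries, every row and every column sums to at most 1. -/
def Substochastic (M T : ℕ) (A : ℕ → ℕ → ℝ) : Prop :=
  (∀ x t, 0 ≤ A x t) ∧
  (∀ x ∈ Icc 1 M, ∑ t ∈ Icc 1 T, A x t ≤ 1) ∧
  (∀ t ∈ Icc 1 T, ∑ x ∈ Icc 1 M, A x t ≤ 1)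

/-- `N̄_A(x,t)`: the probability that `A` does not visit box `x` by (and including) round `t`. -/
def Nbar (A : ℕ → ℕ → ℝ) (x t : ℕ) : ℝ := 1 - ∑ s ∈ Icc 1 t, A x s

/-- `f` is a positive, nonincreasing probability distribution on boxes `1..M`. -/
def BoxDist (M : ℕ) (f : ℕ → ℝ) : Prop :=
  (∀ x ∈ Icc 1 M, 0 < f x) ∧
  (∀ x, 1 ≤ x → x + 1 ≤ M → f (x + 1) ≤ f x) ∧
  (∑ x ∈ Icc 1 M, f x = 1)

/-- `C` is a congestion policy for `k` players: nonnegative, nonincreasing on `1..k`,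
`C 1 = 1`, and `C ℓ < 1` for some `ℓ ≤ k`. -/
def Policy (k : ℕ) (C : ℕ → ℝ) : Prop :=
  (∀ ℓ, 1 ≤ ℓ → ℓ ≤ k → 0 ≤ C ℓ) ∧ (C 1 = 1) ∧
  (∀ ℓ ℓ', 1 ≤ ℓ → ℓ ≤ ℓ' → ℓ' ≤ k → C ℓ' ≤ C ℓ) ∧
  (∃ ℓ, 1 ≤ ℓ ∧ ℓ ≤ k ∧ C ℓ < 1)

/-- The value of box `x` at round `t` against `k-1` copies of `A`. -/
def val (k : ℕ) (C f : ℕ → ℝ) (A : ℕ → ℕ → ℝ) (x t : ℕ) : ℝ :=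
  f x * ∑ ℓ ∈ range k,
    C (ℓ + 1) * ((k - 1).choose ℓ : ℝ) * A x t ^ ℓ * Nbar A x t ^ (k - 1 - ℓ)

/-- The utility of `B` against `k-1` copies of `A`. -/
def util (M T k : ℕ) (C f : ℕ → ℝ) (A B : ℕ → ℕ → ℝ) : ℝ :=
  ∑ t ∈ Icc 1 T, ∑ x ∈ Icc 1 M, B x t * val k C f A x t

/-- `A` is non-redundant: each column `t ≤ min T M` sums to exactly 1. -/
def NonRedundant (M T : ℕ) (A : ℕ → ℕ → ℝ) : Prop :=
  ∀ t, 1 ≤ t → t ≤ min T M → ∑ x ∈ Icc 1 M, A x t = 1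

/-- `A` is self-greedy: for each round `t ≤ T` it is greedy at round `t` with respect to
`k-1` copies of itself. -/
def SGreedy (M T k : ℕ) (C f : ℕ → ℝ) (A : ℕ → ℕ → ℝ) : Prop :=
  ∀ t, 1 ≤ t → t ≤ T → ∀ B, Substochastic M T B →
    (∀ x s, s < t → B x s = A x s) →
    ∑ x ∈ Icc 1 M, B x t * val k C f A x t ≤ ∑ x ∈ Icc 1 M, A x t * val k C f A x t

/-- The exclusive congestion policy: `C_ex(1) = 1`, `C_ex(ℓ) = 0` for `ℓ ≥ 2`. -/
def Cex : ℕ → ℝ := fun ℓ => if ℓ ≤ 1 then 1 else 0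

theorem Nbar_zero (A : ℕ → ℕ → ℝ) (x : ℕ) : Nbar A x 0 = 1 := by
  simp [Nbar]

theorem Nbar_succ (A : ℕ → ℕ → ℝ) (x t : ℕ) : Nbar A x (t + 1) = Nbar A x t - A x (t + 1) := by
  simp only [Nbar, Finset.sum_Icc_succ_top (Nat.le_add_left 1 t)]
  ring

theorem Nbar_le_one {A : ℕ → ℕ → ℝ} (hA : ∀ x t, 0 ≤ A x t) (x t : ℕ) : Nbar A x t ≤ 1 :=
  sub_le_self _ (Finset.sum_nonneg fun s _ => hA x s)

/-- Under the exclusive policy a box only pays when none of the other players visits it. -/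
theorem val_Cex {k : ℕ} (hk : 1 ≤ k) (f : ℕ → ℝ) (A : ℕ → ℕ → ℝ) (x t : ℕ) :
    val k Cex f A x t = f x * Nbar A x t ^ (k - 1) := by
  unfold _root_.val
  rw [Finset.sum_eq_single_of_mem 0 (Finset.mem_range.2 hk)]
  · simp [Cex]
  · intro ℓ _ hℓ
    simp [Cex, hℓ]

theorem mul_rpow_neg_inv_pow {k : ℕ} (hk : 2 ≤ k) {y : ℝ} (hy : 0 < y) (a : ℝ) :
    y * (a * y ^ (-(1 : ℝ) / ((k : ℝ) - 1))) ^ (k - 1) = a ^ (k - 1) := by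
  have hk1 : ((k - 1 : ℕ) : ℝ) = (k : ℝ) - 1 := by
    rw [Nat.cast_sub (by omega), Nat.cast_one]
  have hk0 : (k : ℝ) - 1 ≠ 0 := by
    have : (2 : ℝ) ≤ k := by exact_mod_cast hk
    linarith
  rw [mul_pow, ← Real.rpow_natCast (y ^ _), ← Real.rpow_mul hy.le, hk1, div_mul_cancel₀ _ hk0,
    Real.rpow_neg_one]
  field_simp

/-- If the survival probabilities sum to `M - t` at every round `t ≤ min T M`, then no round is
wasted. -/
theorem nonRedundant_of_sum_Nbar {M T : ℕ} {A : ℕ → ℕ → ℝ}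
    (h : ∀ t, 1 ≤ t → t ≤ min T M → ∑ x ∈ Icc 1 M, Nbar A x t = (M : ℝ) - (t : ℝ)) :
    NonRedundant M T A := by
  intro t ht htM
  obtain ⟨t, rfl⟩ := Nat.exists_eq_add_of_le' ht
  have hprev : ∑ x ∈ Icc 1 M, Nbar A x t = (M : ℝ) - (t : ℝ) := by
    rcases Nat.eq_zero_or_pos t with rfl | h0
    · simp [Nbar_zero]
    · exact h t h0 (by omega)
  have hnext := h (t + 1) ht htM
  simp only [Nbar_succ, Finset.sum_sub_distrib, hprev] at hnext
  push_cast at hnext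
  linarith

/-- A column that sums to one and is supported on boxes of maximal value `c` is optimal among
substochastic columns. -/
theorem sum_mul_le_of_support_maximal {ι : Type*} {s : Finset ι} {a b v : ι → ℝ} {c : ℝ}
    (hc : 0 ≤ c) (hv : ∀ x ∈ s, v x ≤ c) (hb : ∀ x ∈ s, 0 ≤ b x) (hb1 : ∑ x ∈ s, b x ≤ 1)
    (ha1 : ∑ x ∈ s, a x = 1) (hav : ∀ x ∈ s, a x ≠ 0 → v x = c) :
    ∑ x ∈ s, b x * v x ≤ ∑ x ∈ s, a x * v x :=
  calc ∑ x ∈ s, b x * v x ≤ ∑ x ∈ s, b x * c :=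
        Finset.sum_le_sum fun x hx => mul_le_mul_of_nonneg_left (hv x hx) (hb x hx)
    _ = (∑ x ∈ s, b x) * c := (Finset.sum_mul ..).symm
    _ ≤ (∑ x ∈ s, a x) * c := by rw [ha1]; exact mul_le_mul_of_nonneg_right hb1 hc
    _ = ∑ x ∈ s, a x * c := Finset.sum_mul ..
    _ = ∑ x ∈ s, a x * v x := Finset.sum_congr rfl fun x hx => by
        by_cases h : a x = 0
        · simp [h]
        · rw [hav x hx h]

/-- under the exclusive policy, if `T ≤ M` then the strategy `A★`
(characterized by `N̄(x,t) = min 1 (α(t)·f(x)^{-1/(k-1)})` with `∑_x N̄(x,t) = M - t`)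
is non-redundant and sgreedy. -/
theorem Astar_nonredundant_sgreedy
    (M T k : ℕ) (hM : 1 ≤ M) (hT : 1 ≤ T) (hk : 2 ≤ k) (hTM : T ≤ M)
    (f : ℕ → ℝ) (hf : BoxDist M f)
    (Astar : ℕ → ℕ → ℝ) (hsub : Substochastic M T Astar)
    (hchar : ∀ t, 1 ≤ t → t ≤ min T M → ∃ α : ℝ, 0 ≤ α ∧
      (∀ x ∈ Icc 1 M, Nbar Astar x t = min 1 (α * f x ^ (-(1 : ℝ) / ((k : ℝ) - 1)))) ∧
      (∑ x ∈ Icc 1 M, Nbar Astar x t = (M : ℝ) - (t : ℝ))) :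
    NonRedundant M T Astar ∧ SGreedy M T k Cex f Astar := by
  have hnr : NonRedundant M T Astar := nonRedundant_of_sum_Nbar fun t ht htM =>
    let ⟨_, _, _, h⟩ := hchar t ht htM
    h
  refine ⟨hnr, fun t ht htT B hB _ => ?_⟩
  have htM : t ≤ min T M := le_min htT (htT.trans hTM)
  obtain ⟨α, hα, hN, -⟩ := hchar t ht htM
  refine sum_mul_le_of_support_maximal (pow_nonneg hα (k - 1)) (fun x hx => ?_)
    (fun x _ => hB.1 x t) (hB.2.2 t (Finset.mem_Icc.2 ⟨ht, htT⟩)) (hnr t ht htM)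
    (fun x hx hAx => ?_)
  · have hfx := hf.1 x hx
    have hβ : 0 ≤ α * f x ^ (-(1 : ℝ) / ((k : ℝ) - 1)) := by positivity
    rw [val_Cex (by omega), hN x hx, ← mul_rpow_neg_inv_pow hk hfx α]
    gcongr
    exact min_le_right _ _
  · have hlt : Nbar Astar x t < 1 := by
      obtain ⟨t, rfl⟩ := Nat.exists_eq_add_of_le' ht
      have hpos := (hsub.1 x (t + 1)).lt_of_ne' hAx
      have hle := Nbar_le_one hsub.1 x t
      rw [Nbar_succ]
      linarith
    have hβ : Nbar Astar x t = α * f x ^ (-(1 : ℝ) / ((k : ℝ) - 1)) := by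
      rw [hN x hx] at hlt ⊢
      exact min_eq_right ((min_lt_iff.1 hlt).resolve_left (lt_irrefl 1)).le
    rw [val_Cex (by omega), hβ, mul_rpow_neg_inv_pow hk (hf.1 x hx)]
end

section
/- For any congestion policy C, if a strategy A is a symmetric equilibrium for k players, then A is non-redundant. -/
open Finset

/-- `A` is a symmetric equilibrium for `k` players. -/
def SymEquilibrium (M T k : ℕ) (C f : ℕ → ℝ) (A : ℕ → ℕ → ℝ) : Prop :=
  ∀ B, Substochastic M T B → util M T k C f A B ≤ util M T k C f A A

/-- Moving probability within the row of box `x`: an equilibrium cannot profit from adding `ε`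
at round `t` while removing `δ` at round `r`. -/
theorem SymEquilibrium.mul_val_le {M T k : ℕ} {C f : ℕ → ℝ} {A : ℕ → ℕ → ℝ}
    (hEq : SymEquilibrium M T k C f A) (hA : Substochastic M T A) {x t r : ℕ}
    (hx : x ∈ Icc 1 M) (ht : t ∈ Icc 1 T) (hr : r ∈ Icc 1 T) {ε δ : ℝ}
    (hε : 0 ≤ ε) (hδ : 0 ≤ δ) (hδA : δ ≤ A x r)
    (hcol : ∑ y ∈ Icc 1 M, A y t + ε ≤ 1)
    (hrow : ∑ s ∈ Icc 1 T, A x s + ε - δ ≤ 1) :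
    ε * val k C f A x t ≤ δ * val k C f A x r := by
  obtain ⟨hA0, hArow, hAcol⟩ := hA
  let D : ℕ → ℝ := fun s => (if s = t then ε else 0) - (if s = r then δ else 0)
  let B : ℕ → ℕ → ℝ := fun y s => A y s + (if y = x then D s else 0)
  have hBrow (y : ℕ) : ∑ s ∈ Icc 1 T, B y s
      = ∑ s ∈ Icc 1 T, A y s + (if y = x then ε - δ else 0) := by
    by_cases hy : y = x
    · simp only [B, D, hy, if_true, sum_add_distrib, sum_sub_distrib, sum_ite_eq', ht, hr]
    · simp [B, hy]
  have hBcol (s : ℕ) : ∑ y ∈ Icc 1 M, B y s = ∑ y ∈ Icc 1 M, A y s + D s := by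
    simp only [B, sum_add_distrib, sum_ite_eq', hx, if_true]
  have hB : Substochastic M T B := by
    refine ⟨fun y s => ?_, fun y hy => ?_, fun s hs => ?_⟩
    · have h0 := hA0 y s
      simp only [B, D]
      split_ifs <;> subst_vars <;> linarith
    · have h1 := hArow y hy
      rw [hBrow]
      split_ifs with h
      · subst h; linarith
      · linarith
    · have h1 := hAcol s hs
      rw [hBcol]
      simp only [D]
      split_ifs <;> subst_vars <;> linarith
  have hutil : util M T k C f A B
      = util M T k C f A A + (ε * val k C f A x t - δ * val k C f A x r) := by
    simp only [util, B, D, add_mul, sum_add_distrib, ite_mul, zero_mul, sum_ite_eq', hx, if_true,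
      sub_mul, sum_sub_distrib, ht, hr]
  have := hEq B hB
  linarith

theorem Nbar_antitone {A : ℕ → ℕ → ℝ} (hA : ∀ x t, 0 ≤ A x t) (x : ℕ) : Antitone (Nbar A x) := by
  intro s t hst
  have := sum_le_sum_of_subset_of_nonneg (Icc_subset_Icc_right (a := 1) hst)
    (fun i _ _ => hA x i)
  simp only [Nbar]
  linarith

theorem add_Nbar_le {A : ℕ → ℕ → ℝ} (hA : ∀ x t, 0 ≤ A x t) (x : ℕ) {t r : ℕ} (htr : t < r) :
    A x r + Nbar A x r ≤ Nbar A x t := by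
  obtain ⟨r, rfl⟩ : ∃ n, r = n + 1 := ⟨r - 1, by omega⟩
  have h := Nbar_antitone hA x (Nat.le_of_lt_succ htr)
  have h1 : Nbar A x (r + 1) = Nbar A x r - A x (r + 1) := by
    simp only [Nbar, sum_Icc_succ_top (Nat.le_add_left 1 r)]
    ring
  linarith

theorem mul_Nbar_pow_le_val {k : ℕ} {C f : ℕ → ℝ} {A : ℕ → ℕ → ℝ} {x t : ℕ} (hk : 1 ≤ k)
    (hC : Policy k C) (hf : 0 ≤ f x) (hA : 0 ≤ A x t) (hN : 0 ≤ Nbar A x t) :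
    f x * Nbar A x t ^ (k - 1) ≤ val k C f A x t := by
  refine mul_le_mul_of_nonneg_left ?_ hf
  have h := single_le_sum (s := range k) (f := fun ℓ =>
    C (ℓ + 1) * ((k - 1).choose ℓ : ℝ) * A x t ^ ℓ * Nbar A x t ^ (k - 1 - ℓ))
    (fun ℓ hℓ => by
      have := hC.1 (ℓ + 1) (by omega) (by have := mem_range.1 hℓ; omega)
      positivity) (mem_range.2 (show 0 < k by omega))
  simpa [hC.2.1] using h

theorem val_lt_mul_add_pow {k : ℕ} {C f : ℕ → ℝ} {A : ℕ → ℕ → ℝ} {x t : ℕ} (hk : 1 ≤ k)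
    (hC : Policy k C) (hf : 0 < f x) (hA : 0 < A x t) (hN : 0 ≤ Nbar A x t) :
    val k C f A x t < f x * (A x t + Nbar A x t) ^ (k - 1) := by
  obtain ⟨-, hC1, hCanti, m, hm1, hmk, hm⟩ := hC
  have hCk : C k < 1 := (hCanti m k hm1 hmk le_rfl).trans_lt hm
  refine mul_lt_mul_of_pos_left ?_ hf
  rw [add_pow, Nat.sub_add_cancel hk]
  refine sum_lt_sum (fun ℓ hℓ => ?_) ⟨k - 1, mem_range.2 (by omega), ?_⟩
  · have hCl : C (ℓ + 1) ≤ 1 :=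
      hC1 ▸ hCanti 1 (ℓ + 1) le_rfl (by omega) (by have := mem_range.1 hℓ; omega)
    have : 0 ≤ A x t ^ ℓ * Nbar A x t ^ (k - 1 - ℓ) * ((k - 1).choose ℓ : ℝ) := by positivity
    nlinarith
  · simpa [Nat.sub_add_cancel hk] using mul_lt_mul_of_pos_right hCk (pow_pos hA (k - 1))

/-- If every box is surely visited but some column `t ≤ M` is not full, then some round after
round `M` is used. -/
theorem Substochastic.exists_pos_of_col_lt {M T : ℕ} {A : ℕ → ℕ → ℝ} (hA : Substochastic M T A)
    (hrow : ∀ x ∈ Icc 1 M, 1 ≤ ∑ t ∈ Icc 1 T, A x t) {t : ℕ} (ht : t ∈ Icc 1 T) (htM : t ≤ M)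
    (hcol : ∑ x ∈ Icc 1 M, A x t < 1) :
    ∃ x ∈ Icc 1 M, ∃ r ∈ Icc 1 T, M < r ∧ 0 < A x r := by
  by_contra! h
  have h1 : (M : ℝ) ≤ ∑ x ∈ Icc 1 M, ∑ s ∈ Icc 1 T, A x s := by
    simpa using sum_le_sum hrow
  have h2 : ∑ s ∈ Icc 1 T, ∑ x ∈ Icc 1 M, A x s
      < ∑ s ∈ Icc 1 T, if s ≤ M then (1 : ℝ) else 0 := by
    refine sum_lt_sum (fun s hs => ?_) ⟨t, ht, by simpa [htM] using hcol⟩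
    split_ifs with hsM
    · exact hA.2.2 s hs
    · exact sum_nonpos fun x hx => h x hx s hs (not_le.1 hsM)
  have h3 : (∑ s ∈ Icc 1 T, if s ≤ M then (1 : ℝ) else 0) ≤ M := by
    rw [sum_boole]
    have : #{s ∈ Icc 1 T | s ≤ M} ≤ #(Icc 1 M) := card_le_card fun s hs => by
      simp only [mem_filter, mem_Icc] at hs ⊢
      omega
    rw [Nat.card_Icc, Nat.add_sub_cancel] at this
    exact_mod_cast this
  rw [sum_comm] at h1
  linarith

/-- for any congestion policy, a symmetric equilibrium is non-redundant. -/
theorem symmetric_equilibrium_non_redundant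
    (M T k : ℕ) (hM : 1 ≤ M) (hT : 1 ≤ T) (hk : 2 ≤ k)
    (C f : ℕ → ℝ) (hC : Policy k C) (hf : BoxDist M f)
    (A : ℕ → ℕ → ℝ) (hA : Substochastic M T A)
    (hEq : SymEquilibrium M T k C f A) :
    NonRedundant M T A := by
  intro t ht1 htm
  have ht : t ∈ Icc 1 T := mem_Icc.2 ⟨ht1, htm.trans (min_le_left _ _)⟩
  have htM : t ≤ M := htm.trans (min_le_right _ _)
  by_contra hne
  have hcol : ∑ x ∈ Icc 1 M, A x t < 1 := lt_of_le_of_ne (hA.2.2 t ht) hne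
  have hNT (x : ℕ) {s : ℕ} (hs : s ∈ Icc 1 T) : 1 - ∑ r ∈ Icc 1 T, A x r ≤ Nbar A x s :=
    Nbar_antitone hA.1 x (mem_Icc.1 hs).2
  have hN {x s : ℕ} (hx : x ∈ Icc 1 M) (hs : s ∈ Icc 1 T) : 0 ≤ Nbar A x s := by
    linarith [hNT x hs, hA.2.1 x hx]
  have hlow {x s : ℕ} (hx : x ∈ Icc 1 M) (hs : s ∈ Icc 1 T) :=
    mul_Nbar_pow_le_val (by omega : 1 ≤ k) hC (hf.1 x hx).le (hA.1 x s) (hN hx hs)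
  by_cases hrow : ∀ x ∈ Icc 1 M, 1 ≤ ∑ s ∈ Icc 1 T, A x s
  · obtain ⟨x, hx, r, hr, hMr, hpos⟩ := hA.exists_pos_of_col_lt hrow ht htM hcol
    have hfx := hf.1 x hx
    have hlt : val k C f A x r < val k C f A x t :=
      calc val k C f A x r < f x * (A x r + Nbar A x r) ^ (k - 1) :=
            val_lt_mul_add_pow (by omega) hC hfx hpos (hN hx hr)
        _ ≤ f x * Nbar A x t ^ (k - 1) := by
            have := hN hx hr
            have := add_Nbar_le hA.1 x (htM.trans_lt hMr)
            gcongr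
        _ ≤ val k C f A x t := hlow hx ht
    have hε : 0 < min (1 - ∑ y ∈ Icc 1 M, A y t) (A x r) := lt_min (by linarith) hpos
    have h := hEq.mul_val_le hA hx ht hr hε.le hε.le (min_le_right _ _)
      (by linarith [min_le_left (1 - ∑ y ∈ Icc 1 M, A y t) (A x r)])
      (by linarith [hA.2.1 x hx])
    exact absurd (le_of_mul_le_mul_left h hε) (not_le.2 hlt)
  · push Not at hrow
    obtain ⟨x, hx, hxlt⟩ := hrow
    have hNpos : 0 < Nbar A x t := by linarith [hNT x ht]
    have hval : 0 < val k C f A x t :=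
      (mul_pos (hf.1 x hx) (pow_pos hNpos _)).trans_le (hlow hx ht)
    have hε : 0 < min (1 - ∑ y ∈ Icc 1 M, A y t) (1 - ∑ s ∈ Icc 1 T, A x s) :=
      lt_min (by linarith) (by linarith)
    have h := hEq.mul_val_le hA hx ht ht hε.le le_rfl (hA.1 x t)
      (by linarith [min_le_left (1 - ∑ y ∈ Icc 1 M, A y t) (1 - ∑ s ∈ Icc 1 T, A x s)])
      (by linarith [min_le_right (1 - ∑ y ∈ Icc 1 M, A y t) (1 - ∑ s ∈ Icc 1 T, A x s)])
    linarith [mul_pos hε hval]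
end

section
/- Let k ≥ 2 and let C : {1,…,k} → [0,∞) be nonincreasing with C(1) = 1. Let q ∈ (0,1], p ≥ 0 and ε > 0 with p + ε ≤ q, and define φ(p) = Σ_{i=0}^{k−1} C(i+1)·binom(k−1,i)·p^i·(q−p)^{k−1−i}. Then ((1 − C(k))/(k−1))·ε^{k−1} ≤ φ(p) − φ(p+ε) ≤ 4^{k−1}·ε. -/
open Finset

/-- The homogeneous Bernstein form of degree `n` with coefficients `D 0, …, D n`. -/
def bernsteinForm (n : ℕ) (D : ℕ → ℝ) (x y : ℝ) : ℝ :=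
  ∑ i ∈ range (n + 1), D i * (n.choose i : ℝ) * x ^ i * y ^ (n - i)

theorem bernsteinForm_zero (D : ℕ → ℝ) (x y : ℝ) : bernsteinForm 0 D x y = D 0 := by
  simp [bernsteinForm]

theorem bernsteinForm_succ (n : ℕ) (D : ℕ → ℝ) (x y : ℝ) :
    bernsteinForm (n + 1) D x y =
      y * bernsteinForm n D x y + x * bernsteinForm n (fun i => D (i + 1)) x y := by
  have h := sum_choose_succ_mul (fun i j => D i * x ^ i * y ^ j) n
  simp only [bernsteinForm, mul_sum]
  refine Eq.trans (sum_congr rfl fun i _ => ?_)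
    (h.trans (congrArg₂ (· + ·) (sum_congr rfl fun i hi => ?_)
      (sum_congr rfl fun i _ => ?_)))
  · ring
  · rw [Nat.succ_sub (Nat.lt_succ_iff.mp (mem_range.mp hi)), pow_succ]
    ring
  · ring

theorem bernsteinForm_nonneg {n : ℕ} {D : ℕ → ℝ} {x y : ℝ} (hD : ∀ i ≤ n, 0 ≤ D i)
    (hx : 0 ≤ x) (hy : 0 ≤ y) : 0 ≤ bernsteinForm n D x y := by
  refine sum_nonneg fun i hi => ?_
  have := hD i (Nat.lt_succ_iff.mp (mem_range.mp hi))
  positivity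

theorem bernsteinForm_le_one {n : ℕ} {D : ℕ → ℝ} {x y : ℝ} (hD : ∀ i ≤ n, D i ≤ 1)
    (hx : 0 ≤ x) (hy : 0 ≤ y) (hxy : x + y ≤ 1) : bernsteinForm n D x y ≤ 1 := by
  induction n generalizing D with
  | zero => simpa [bernsteinForm_zero] using hD 0 le_rfl
  | succ n ih =>
    rw [bernsteinForm_succ]
    have h₁ := ih (D := D) fun i hi => hD i (by lia)
    have h₂ := ih (D := fun i => D (i + 1)) fun i hi => hD (i + 1) (by lia)
    linarith [mul_le_mul_of_nonneg_left h₁ hy, mul_le_mul_of_nonneg_left h₂ hx]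

theorem bernsteinForm_succ_sub (n : ℕ) (D E : ℕ → ℝ) (a b c : ℝ) :
    bernsteinForm (n + 1) D a (c + b) - bernsteinForm (n + 1) E (a + b) c =
      c * (bernsteinForm n D a (c + b) - bernsteinForm n E (a + b) c) +
      a * (bernsteinForm n (fun i => D (i + 1)) a (c + b) -
        bernsteinForm n (fun i => E (i + 1)) (a + b) c) +
      b * (bernsteinForm n D a (c + b) - bernsteinForm n (fun i => E (i + 1)) (a + b) c) := by
  simp only [bernsteinForm_succ]
  ring

theorem le_bernsteinForm_sub {n : ℕ} {D E : ℕ → ℝ} {a b c : ℝ}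
    (h : ∀ i j, i ≤ j → j ≤ n → E j ≤ D i) (ha : 0 ≤ a) (hb : 0 ≤ b) (hc : 0 ≤ c) :
    (D 0 - E n) * b ^ n ≤ bernsteinForm n D a (c + b) - bernsteinForm n E (a + b) c := by
  induction n generalizing D E with
  | zero => simp [bernsteinForm_zero]
  | succ n ih =>
    have h₁ : 0 ≤ bernsteinForm n D a (c + b) - bernsteinForm n E (a + b) c :=
      (mul_nonneg (sub_nonneg.mpr (h 0 n (by lia) (by lia))) (pow_nonneg hb n)).trans
        (ih fun i j hij hj => h i j hij (by lia))
    have h₂ : 0 ≤ bernsteinForm n (fun i => D (i + 1)) a (c + b) -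
        bernsteinForm n (fun i => E (i + 1)) (a + b) c :=
      (mul_nonneg (sub_nonneg.mpr (h 1 (n + 1) (by lia) le_rfl)) (pow_nonneg hb n)).trans
        (ih fun i j hij hj => h (i + 1) (j + 1) (by lia) (by lia))
    have h₃ := ih (D := D) (E := fun i => E (i + 1))
      fun i j hij hj => h i (j + 1) (by lia) (by lia)
    rw [bernsteinForm_succ_sub, pow_succ]
    linarith [mul_nonneg hc h₁, mul_nonneg ha h₂, mul_le_mul_of_nonneg_left h₃ hb]

theorem bernsteinForm_sub_le {n : ℕ} {D : ℕ → ℝ} {a b c : ℝ}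
    (hD₀ : ∀ i ≤ n, 0 ≤ D i) (hD₁ : ∀ i ≤ n, D i ≤ 1)
    (ha : 0 ≤ a) (hb : 0 ≤ b) (hc : 0 ≤ c) (habc : a + b + c ≤ 1) :
    bernsteinForm n D a (c + b) - bernsteinForm n D (a + b) c ≤ n * b := by
  induction n generalizing D with
  | zero => simp [bernsteinForm_zero]
  | succ n ih =>
    have h₁ := ih (D := D) (fun i hi => hD₀ i (by lia)) (fun i hi => hD₁ i (by lia))
    have h₂ := ih (D := fun i => D (i + 1)) (fun i hi => hD₀ (i + 1) (by lia))
      (fun i hi => hD₁ (i + 1) (by lia))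
    have h₃ : bernsteinForm n D a (c + b) ≤ 1 :=
      bernsteinForm_le_one (fun i hi => hD₁ i (by lia)) ha (by positivity) (by linarith)
    have h₄ : 0 ≤ bernsteinForm n (fun i => D (i + 1)) (a + b) c :=
      bernsteinForm_nonneg (fun i hi => hD₀ (i + 1) (by lia)) (by positivity) hc
    have h₅ : (c + a) * (n * b) ≤ 1 * (n * b) :=
      mul_le_mul_of_nonneg_right (by linarith) (by positivity)
    rw [bernsteinForm_succ_sub]
    push_cast
    linarith [mul_le_mul_of_nonneg_left h₁ hc, mul_le_mul_of_nonneg_left h₂ ha,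
      mul_le_mul_of_nonneg_left h₃ hb, mul_nonneg hb h₄]

/-- bounds on the decrement of
`φ(p) = Σ_{i=0}^{k-1} C(i+1)·binom(k-1,i)·p^i·(q-p)^{k-1-i}`:
`((1 - C k)/(k-1))·ε^{k-1} ≤ φ(p) - φ(p+ε) ≤ 4^{k-1}·ε`. -/
theorem phi_decrement_bounds
    (k : ℕ) (hk : 2 ≤ k) (C : ℕ → ℝ)
    (hnn : ∀ ℓ, 1 ≤ ℓ → ℓ ≤ k → 0 ≤ C ℓ) (h1 : C 1 = 1)
    (hmono : ∀ ℓ ℓ', 1 ≤ ℓ → ℓ ≤ ℓ' → ℓ' ≤ k → C ℓ' ≤ C ℓ)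
    (q p ε : ℝ) (hq0 : 0 < q) (hq1 : q ≤ 1) (hp : 0 ≤ p) (hε : 0 < ε) (hpε : p + ε ≤ q) :
    (1 - C k) / ((k : ℝ) - 1) * ε ^ (k - 1) ≤
      (∑ i ∈ range k, C (i + 1) * ((k - 1).choose i : ℝ) * p ^ i * (q - p) ^ (k - 1 - i)) -
      (∑ i ∈ range k,
        C (i + 1) * ((k - 1).choose i : ℝ) * (p + ε) ^ i * (q - (p + ε)) ^ (k - 1 - i)) ∧
    (∑ i ∈ range k, C (i + 1) * ((k - 1).choose i : ℝ) * p ^ i * (q - p) ^ (k - 1 - i)) -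
      (∑ i ∈ range k,
        C (i + 1) * ((k - 1).choose i : ℝ) * (p + ε) ^ i * (q - (p + ε)) ^ (k - 1 - i)) ≤
      4 ^ (k - 1) * ε := by
  obtain ⟨n, rfl⟩ : ∃ n, k = n + 1 := ⟨k - 1, by lia⟩
  have hn : (1 : ℝ) ≤ n := by exact_mod_cast (by lia : 1 ≤ n)
  have hc : 0 ≤ q - (p + ε) := by linarith
  have hlower := le_bernsteinForm_sub (n := n) (D := fun i => C (i + 1))
    (E := fun i => C (i + 1))
    (fun i j hij hj => hmono (i + 1) (j + 1) (by lia) (by lia) (by lia)) hp hε.le hc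
  have hupper := bernsteinForm_sub_le (n := n) (D := fun i => C (i + 1))
    (fun i hi => hnn (i + 1) (by lia) (by lia))
    (fun i hi => h1 ▸ hmono 1 (i + 1) le_rfl (by lia) (by lia)) hp hε.le hc (by linarith)
  have hq : q - (p + ε) + ε = q - p := by ring
  simp only [hq, bernsteinForm, zero_add, h1] at hlower hupper
  simp only [Nat.add_sub_cancel, Nat.cast_add, Nat.cast_one, add_sub_cancel_right]
  refine ⟨le_trans ?_ hlower, hupper.trans ?_⟩
  · have hCk : 0 ≤ 1 - C (n + 1) :=
      sub_nonneg.mpr (h1 ▸ hmono 1 (n + 1) le_rfl (by lia) le_rfl)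
    exact mul_le_mul_of_nonneg_right (div_le_self hCk hn) (by positivity)
  · refine mul_le_mul_of_nonneg_right ?_ hε.le
    exact_mod_cast (Nat.lt_pow_self (by norm_num : 1 < 4) : n < 4 ^ n).le
end
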